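/- Let G be an interval graph and let v be an end vertex of G. Then there exists a clique path K₁, …, K_ℓ of G such that v is a simplicial vertex of G belonging to the first maximal clique K₁. -/

import Mathlib

open SimpleGraph

/-- `G` is an interval graph: each vertex can be assigned a closed real interval so that
distinct vertices are adjacent iff their intervals intersect. -/
def IsIntervalGraph {V : Type*} (G : SimpleGraph V) : Prop :=
  ∃ I : V → Set ℝ,
    (∀ v, ∃ a b : ℝ, a ≤ b ∧ I v = Set.Icc a b) ∧
    ∀ u v : V, u ≠ v → (G.Adj u v ↔ (I u ∩ I v).Nonempty)

section Orderings

variable {V : Type*} [Finite V]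

/-- An interval ordering: for `u <σ v <σ w`, `uw ∈ E` implies `uv ∈ E`. -/
def IsIntervalOrdering (G : SimpleGraph V) (σ : V ≃ Fin (Nat.card V)) : Prop :=
  ∀ u v w : V, σ u < σ v → σ v < σ w → G.Adj u w → G.Adj u v

/-- An umbrella ordering: for `u <σ v <σ w`, `uw ∈ E` iff `uv ∈ E` and `vw ∈ E`. -/
def IsUmbrellaOrdering (G : SimpleGraph V) (σ : V ≃ Fin (Nat.card V)) : Prop :=
  ∀ u v w : V, σ u < σ v → σ v < σ w → (G.Adj u w ↔ G.Adj u v ∧ G.Adj v w)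

/-- A unit interval graph: a graph admitting an umbrella ordering. -/
def IsUnitIntervalGraph (G : SimpleGraph V) : Prop :=
  ∃ σ : V ≃ Fin (Nat.card V), IsUmbrellaOrdering G σ

/-- An LBFS ordering: for all `a <σ b <σ c` with `ac ∈ E` and `ab ∉ E` there is `d <σ a`
with `db ∈ E` and `dc ∉ E`. -/
def IsLBFSOrdering (G : SimpleGraph V) (σ : V ≃ Fin (Nat.card V)) : Prop :=
  ∀ a b c : V, σ a < σ b → σ b < σ c → G.Adj a c → ¬ G.Adj a b →
    ∃ d : V, σ d < σ a ∧ G.Adj d b ∧ ¬ G.Adj d c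

/-- An end vertex: the last vertex of some LBFS ordering. -/
def IsEndVertex (G : SimpleGraph V) (v : V) : Prop :=
  ∃ σ : V ≃ Fin (Nat.card V), IsLBFSOrdering G σ ∧ ∀ u, σ u ≤ σ v

/-- `N_σ(v)`: the neighbors of `v` preceding `v` in `σ`. -/
def earlyNbhd (G : SimpleGraph V) (σ : V ≃ Fin (Nat.card V)) (v : V) : Set V :=
  {u | σ u < σ v ∧ G.Adj u v}

/-- The snapshot `S_σ(v)`: vertices `w` not before `v` whose neighborhood among the
vertices preceding `v` equals `N_σ(v)`. -/
def snapshot (G : SimpleGraph V) (σ : V ≃ Fin (Nat.card V)) (v : V) : Set V :=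
  {w | σ v ≤ σ w ∧ {u | σ u < σ v ∧ G.Adj u w} = earlyNbhd G σ v}

/-- `τ = LBFS⁺(G, σ)`: `τ` is an LBFS ordering and every vertex is the `σ`-last vertex of
its own `τ`-snapshot. -/
def IsLBFSPlusOf (G : SimpleGraph V) (σ τ : V ≃ Fin (Nat.card V)) : Prop :=
  IsLBFSOrdering G τ ∧ ∀ v w : V, w ∈ snapshot G τ v → σ w ≤ σ v

/-- `v` is exposed from the snapshot `S_σ(x)` in `σ`:
`v ∈ S_σ(x)` and `N(v) \ (N_σ(S) ∪ S) ≠ ∅`. -/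
def ExposedFrom (G : SimpleGraph V) (σ : V ≃ Fin (Nat.card V)) (x v : V) : Prop :=
  v ∈ snapshot G σ x ∧
    (G.neighborSet v \ (earlyNbhd G σ x ∪ snapshot G σ x)).Nonempty

/-- `x` is an end vertex of the subgraph of `G` induced by `S`. -/
def IsEndVertexOn (G : SimpleGraph V) (S : Set V) (x : V) : Prop :=
  ∃ hx : x ∈ S, IsEndVertex (G.induce S) ⟨x, hx⟩

/-- A well-anchored LBFS ordering: each snapshot starts from an exposed vertex if
one exists, and from an end vertex of the induced subgraph otherwise. -/
def IsWellAnchored (G : SimpleGraph V) (σ : V ≃ Fin (Nat.card V)) : Prop :=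
  IsLBFSOrdering G σ ∧ ∀ x : V,
    ((∃ v, ExposedFrom G σ x v) → ExposedFrom G σ x x) ∧
    (¬ (∃ v, ExposedFrom G σ x v) → IsEndVertexOn G (snapshot G σ x) x)

/-- An MCS ordering: each vertex has at least as many earlier neighbors as any
later vertex has among the vertices before it. -/
def IsMCSOrdering (G : SimpleGraph V) (σ : V ≃ Fin (Nat.card V)) : Prop :=
  ∀ v w : V, σ v < σ w →
    {u | σ u < σ v ∧ G.Adj u w}.ncard ≤ (earlyNbhd G σ v).ncard

end Orderings

section CliquePaths

variable {V : Type*}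

/-- A clique path: an injective enumeration of all maximal cliques of `G` such that
for each vertex the set of indices of cliques containing it is a nonempty interval. -/
structure IsCliquePath (G : SimpleGraph V) {ℓ : ℕ} (K : Fin ℓ → Finset V) : Prop where
  injective : Function.Injective K
  maxClique : ∀ i, Maximal G.IsClique (K i : Set V)
  complete : ∀ s : Set V, Maximal G.IsClique s → ∃ i, (K i : Set V) = s
  covers : ∀ v : V, ∃ i, v ∈ K i
  consecutive : ∀ (v : V) (i j k : Fin ℓ), i ≤ j → j ≤ k → v ∈ K i → v ∈ K k → v ∈ K j

/-- `i` is `lp(v)`: the smallest index of a clique containing `v`. -/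
def IsLp {ℓ : ℕ} (K : Fin ℓ → Finset V) (v : V) (i : Fin ℓ) : Prop :=
  v ∈ K i ∧ ∀ j, v ∈ K j → i ≤ j

/-- `i` is `rp(v)`: the largest index of a clique containing `v`. -/
def IsRp {ℓ : ℕ} (K : Fin ℓ → Finset V) (v : V) (i : Fin ℓ) : Prop :=
  v ∈ K i ∧ ∀ j, v ∈ K j → j ≤ i

/-- An ordering is consistent with a clique path if `u <σ v` whenever `lp(u) < lp(v)`. -/
def ConsistentWith [Finite V] {ℓ : ℕ} (σ : V ≃ Fin (Nat.card V))
    (K : Fin ℓ → Finset V) : Prop :=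
  ∀ (u v : V) (iu iv : Fin ℓ), IsLp K u iu → IsLp K v iv → iu < iv → σ u < σ v

/-- A simplicial vertex: its closed neighborhood is a clique. -/
def IsSimplicial (G : SimpleGraph V) (v : V) : Prop :=
  G.IsClique (insert v (G.neighborSet v))

/-- A module of `G`: every outside vertex is adjacent to all of `M` or to none of `M`. -/
def IsGraphModule (G : SimpleGraph V) (M : Set V) : Prop :=
  ∀ x ∉ M, (∀ v ∈ M, G.Adj x v) ∨ (∀ v ∈ M, ¬ G.Adj x v)

/-- True twins: adjacent vertices with the same closed neighborhood. -/
def AreTrueTwins (G : SimpleGraph V) (u v : V) : Prop :=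
  G.Adj u v ∧ insert u (G.neighborSet u) = insert v (G.neighborSet v)

end CliquePaths

section EndVertex

variable {V : Type*}

/-- Two vertices are apart if they are distinct and nonadjacent. -/
def Apart (G : SimpleGraph V) (u w : V) : Prop := u ≠ w ∧ ¬ G.Adj u w

/-- `l` and `r` give the left and right endpoints of an interval model of `G`. -/
structure IsIntervalModel (G : SimpleGraph V) (l r : V → ℝ) : Prop where
  le : ∀ u, l u ≤ r u
  adj_iff : ∀ u w, G.Adj u w ↔ u ≠ w ∧ l u ≤ r w ∧ l w ≤ r u

/-- `b` is reachable from `a` by a walk avoiding the closed neighborhood of `m`. -/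
def ReachAvoiding (G : SimpleGraph V) (m a b : V) : Prop :=
  Apart G m a ∧ Relation.ReflTransGen (fun u w => G.Adj u w ∧ Apart G m w) a b

variable {G : SimpleGraph V}

lemma Apart.symm {u w : V} (h : Apart G u w) : Apart G w u :=
  ⟨h.1.symm, fun e => h.2 e.symm⟩

lemma IsIntervalGraph.exists_model (hG : IsIntervalGraph G) :
    ∃ l r : V → ℝ, IsIntervalModel G l r := by
  obtain ⟨I, hI, hadj⟩ := hG
  choose l r hle hIcc using hI
  refine ⟨l, r, hle, fun u w => ?_⟩
  by_cases huw : u = w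
  · simp [huw]
  · rw [hadj u w huw, hIcc, hIcc, Set.Icc_inter_Icc, Set.nonempty_Icc]
    simp only [sup_le_iff, le_inf_iff]
    have := hle u
    have := hle w
    tauto

namespace IsIntervalModel

variable {l r : V → ℝ}

lemma neg (h : IsIntervalModel G l r) :
    IsIntervalModel G (fun u => -r u) (fun u => -l u) where
  le u := neg_le_neg (h.le u)
  adj_iff u w := by
    rw [h.adj_iff, neg_le_neg_iff, neg_le_neg_iff]
    tauto

lemma apart_iff (h : IsIntervalModel G l r) (u w : V) :
    Apart G u w ↔ r u < l w ∨ r w < l u := by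
  have := h.le u
  rw [Apart, h.adj_iff]
  grind

end IsIntervalModel

namespace ReachAvoiding

lemma refl {m a : V} (h : Apart G m a) : ReachAvoiding G m a a := ⟨h, .refl⟩

lemma apart_left {m a b : V} (h : ReachAvoiding G m a b) : Apart G m a := h.1

lemma step {m a b c : V} (h : ReachAvoiding G m a b) (hbc : G.Adj b c) (hc : Apart G m c) :
    ReachAvoiding G m a c := ⟨h.1, h.2.tail ⟨hbc, hc⟩⟩

/-- Induction along a walk avoiding the closed neighborhood of `m`. -/
lemma induction {m a b : V} (h : ReachAvoiding G m a b) {P : V → Prop} (base : P a)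
    (ind : ∀ u w, ReachAvoiding G m a u → P u → G.Adj u w → Apart G m w → P w) : P b := by
  obtain ⟨ha, h⟩ := h
  induction h with
  | refl => exact base
  | tail hu hw ih => exact ind _ _ ⟨ha, hu⟩ ih hw.1 hw.2

lemma apart_right {m a b : V} (h : ReachAvoiding G m a b) : Apart G m b :=
  h.induction h.1 fun _ _ _ _ _ hw => hw

lemma trans {m a b c : V} (h : ReachAvoiding G m a b) (h' : ReachAvoiding G m b c) :
    ReachAvoiding G m a c := ⟨h.1, h.2.trans h'.2⟩

lemma symm {m a b : V} (h : ReachAvoiding G m a b) : ReachAvoiding G m b a :=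
  h.induction (P := fun u => ReachAvoiding G m u a) (refl h.1) fun _ _ hu ih huw hw =>
    ((refl hw).step huw.symm hu.apart_right).trans ih

/-- A walk avoiding the interval of `m` stays on one side of it. -/
lemma right_lt {l r : V → ℝ} (hm : IsIntervalModel G l r) {m a b : V}
    (h : ReachAvoiding G m a b) (ha : r a < l m) : r b < l m :=
  h.induction (P := fun u => r u < l m) ha fun u w _ hu huw hw => by
    have := hm.le m
    rw [hm.apart_iff] at hw
    rw [hm.adj_iff] at huw
    grind

lemma lt_left {l r : V → ℝ} (hm : IsIntervalModel G l r) {m a b : V}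
    (h : ReachAvoiding G m a b) (ha : r m < l a) : r m < l b :=
  neg_lt_neg_iff.mp (h.right_lt hm.neg (neg_lt_neg ha))

/-- If avoiding `m` does not allow reaching `m'`, then whatever it allows reaching can also be
reached while avoiding `m'`. -/
lemma subset_of_not_reach {m m' a b : V} (h : ReachAvoiding G m a b) (hmm : Apart G m m')
    (hm' : ¬ ReachAvoiding G m a m') : ReachAvoiding G m' a b := by
  have key : ∀ u, ReachAvoiding G m a u → Apart G m' u := fun u hu =>
    ⟨fun e => hm' (e ▸ hu), fun e => hm' (hu.step e.symm hmm)⟩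
  exact h.induction (P := fun u => ReachAvoiding G m' a u) (refl (key _ (refl h.1)))
    fun u w hu ih huw hw => ih.step huw (key w (hu.step huw hw))

/-- A walk from inside a set to outside of it uses an edge leaving the set. -/
lemma exists_exit {m a b : V} (h : ReachAvoiding G m a b) {C : Set V} (ha : a ∈ C)
    (hb : b ∉ C) : ∃ c ∈ C, ∃ s ∉ C, G.Adj c s ∧ ReachAvoiding G m a c ∧
      ReachAvoiding G m a s := by
  by_contra! hcon
  exact hb (h.induction (P := fun u => u ∈ C) ha fun u w hu ih huw hw =>
    by_contra fun hwC => hcon u ih w hwC huw hu (hu.step huw hw))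

/-- A walk from `v` to a vertex apart from `v` passes from `N(v)` to the component of its end
in the complement of `N[v]`. -/
lemma exists_gate {m v b : V} (h : ReachAvoiding G m v b) (hb : Apart G v b) :
    ∃ p p', G.Adj v p ∧ Apart G m p ∧ G.Adj p p' ∧ ReachAvoiding G v b p' := by
  have key : b = v ∨ G.Adj v b ∨
      ∃ p p', G.Adj v p ∧ Apart G m p ∧ G.Adj p p' ∧ ReachAvoiding G v p' b := by
    refine h.induction (P := fun b => b = v ∨ G.Adj v b ∨
      ∃ p p', G.Adj v p ∧ Apart G m p ∧ G.Adj p p' ∧ ReachAvoiding G v p' b) (Or.inl rfl) ?_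
    intro u w hu ih huw hw
    by_cases hwv : w = v
    · exact Or.inl hwv
    by_cases hvw : G.Adj v w
    · exact Or.inr (Or.inl hvw)
    have hfar : Apart G v w := ⟨Ne.symm hwv, hvw⟩
    rcases ih with rfl | ih | ⟨p, p', h1, h2, h3, h4⟩
    · exact absurd huw hvw
    · exact Or.inr (Or.inr ⟨u, w, ih, hu.apart_right, huw, refl hfar⟩)
    · exact Or.inr (Or.inr ⟨p, p', h1, h2, h3, h4.step huw hfar⟩)
  rcases key with rfl | hvb | ⟨p, p', h1, h2, h3, h4⟩
  · exact absurd rfl hb.1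
  · exact absurd hvb hb.2
  · exact ⟨p, p', h1, h2, h3, h4.symm⟩

end ReachAvoiding

section LBFS

variable {σ : V ≃ Fin (Nat.card V)} {v : V}

lemma lt_last_of_ne (hlast : ∀ u, σ u ≤ σ v) {u : V} (h : u ≠ v) : σ u < σ v :=
  lt_of_le_of_ne (hlast u) fun e => h (σ.injective e)

/-- If an earlier neighbor `a` of the last vertex `v` misses `b`, then `b` has a neighbor
before `a` that is apart from `v`. -/
lemma IsLBFSOrdering.exists_earlier (hσ : IsLBFSOrdering G σ) (hlast : ∀ u, σ u ≤ σ v)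
    {a b : V} (hab : σ a < σ b) (hbv : b ≠ v) (hav : G.Adj a v) (hnab : ¬ G.Adj a b) :
    ∃ d, σ d < σ a ∧ G.Adj d b ∧ Apart G v d := by
  obtain ⟨d, h1, h2, h3⟩ := hσ a b v hab (lt_last_of_ne hlast hbv) hav hnab
  refine ⟨d, h1, h2, ?_, fun e => h3 e.symm⟩
  rintro rfl
  exact absurd (h1.trans hab) (not_lt.mpr (hlast b))

lemma no_alternating_triple (hσ : IsLBFSOrdering G σ) (hlast : ∀ u, σ u ≤ σ v) (n : ℕ) :
    ∀ {l r : V → ℝ}, IsIntervalModel G l r → ∀ p q c : V, (σ p : ℕ) = n → σ p < σ q →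
      σ q < σ c → G.Adj p c → r v < l p → l v < l c → r q < r v → r q < l c → False := by
  induction n using Nat.strong_induction_on with
  | _ n ih =>
    intro l r hm p q c hn hpq hqc hpc hp hc hq hqc'
    have hlv := hm.le v
    have hpq' : ¬ G.Adj p q := by
      rw [hm.adj_iff]
      rintro ⟨-, h, -⟩
      linarith
    obtain ⟨d, hdp, hdq, hdc⟩ := hσ p q c hpq hqc hpc hpq'
    have hdne : d ≠ c := by
      rintro rfl
      exact absurd (hdp.trans (hpq.trans hqc)) (lt_irrefl _)
    have hdv : d ≠ v := by
      rintro rfl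
      exact absurd (hdp.trans hpq) (not_lt.mpr (hlast q))
    have hdc' := (hm.apart_iff d c).mp ⟨hdne, hdc⟩
    have hdq' := (hm.adj_iff d q).mp hdq
    by_cases hadj : G.Adj d v
    · have hcv : c ≠ v := by
        rintro rfl
        exact hdc hadj
      obtain ⟨h, h1, h2, h3⟩ :=
        hσ.exists_earlier hlast (hdp.trans (hpq.trans hqc)) hcv hadj hdc
      have h3' := (hm.apart_iff v h).mp h3
      have h2' := (hm.adj_iff h c).mp h2
      refine ih (σ h) (by have := h1.trans hdp; omega) hm h q c rfl
        (h1.trans (hdp.trans hpq)) hqc h2 ?_ hc hq hqc'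
      grind
    · have hdv' := (hm.apart_iff d v).mp ⟨hdv, hadj⟩
      refine ih (σ d) (by omega) hm.neg d p q rfl hdp hpq hdq ?_ ?_ ?_ ?_
      · apply neg_lt_neg
        grind
      · exact neg_lt_neg hq
      · apply neg_lt_neg
        linarith
      · apply neg_lt_neg
        linarith

/-- The last vertex of an LBFS ordering of an interval graph is simplicial. -/
lemma IsLBFSOrdering.neighbors_adj (hσ : IsLBFSOrdering G σ) (hlast : ∀ u, σ u ≤ σ v)
    {l r : V → ℝ} (hm : IsIntervalModel G l r) {a b : V} (ha : G.Adj v a) (hb : G.Adj v b)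
    (hab : a ≠ b) : G.Adj a b := by
  wlog hlt : σ a < σ b generalizing a b
  · exact (this hb ha hab.symm
      (lt_of_le_of_ne (not_lt.mp hlt) fun e => hab (σ.injective e).symm)).symm
  by_contra hnab
  wlog hside : r a < l b generalizing l r
  · refine this hm.neg (neg_lt_neg ?_)
    have := (hm.apart_iff a b).mp ⟨hab, hnab⟩
    tauto
  obtain ⟨d, h1, h2, h3⟩ := hσ.exists_earlier hlast hlt hb.ne' ha.symm hnab
  have ha' := (hm.adj_iff v a).mp ha
  have hb' := (hm.adj_iff v b).mp hb
  have h2' := (hm.adj_iff d b).mp h2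
  have h3' := (hm.apart_iff v d).mp h3
  have := hm.le v
  exact no_alternating_triple hσ hlast _ hm d a b rfl h1 hlt h2 (by grind) (by linarith)
    (by linarith) hside

lemma not_reach_both_of_first_lt (hσ : IsLBFSOrdering G σ) (hlast : ∀ u, σ u ≤ σ v)
    (hcl : ∀ a b, G.Adj v a → G.Adj v b → a ≠ b → G.Adj a b)
    {x₀ y₀ y p p' : V} (hne : ¬ ReachAvoiding G v x₀ y₀)
    (hmin : ∀ u, ReachAvoiding G v y₀ u → σ y₀ ≤ σ u) (hlt : σ x₀ < σ y₀)
    (hy : ReachAvoiding G v y₀ y) (hp : G.Adj v p) (hyp : Apart G y p) (hpp : G.Adj p p')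
    (hp' : ReachAvoiding G v x₀ p') : False := by
  have hy₀ := hy.apart_left
  have hXY : ∀ u, ReachAvoiding G v x₀ u → ¬ G.Adj u y₀ := fun u hu e => hne (hu.step e hy₀)
  have hneq : ∀ u, ReachAvoiding G v x₀ u → σ u ≠ σ y₀ := fun u hu e =>
    hne (σ.injective e ▸ hu)
  have hnbr : ∀ d, σ d < σ y₀ → G.Adj d y₀ → G.Adj v d := by
    intro d h1 h2
    by_contra h3
    have hdv : v ≠ d := by
      rintro rfl
      exact hy₀.2 h2
    exact absurd (hmin d ((ReachAvoiding.refl hy₀).step h2.symm ⟨hdv, h3⟩)) (not_le.mpr h1)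
  have hyp₀ : σ y₀ < σ p := by
    rcases lt_or_ge (σ p) (σ y) with h | h
    · obtain ⟨d, h1, h2, h3⟩ := hσ.exists_earlier hlast h hy.apart_right.1.symm hp.symm
        hyp.symm.2
      exact (hmin d (hy.step h2.symm h3)).trans_lt h1
    · exact (hmin y hy).trans_lt (lt_of_le_of_ne h fun e => hyp.1 (σ.injective e))
  have descent : ∀ n : ℕ, ∀ d a', (σ d : ℕ) = n → ReachAvoiding G v x₀ a' → σ y₀ < σ a' →
      σ d < σ y₀ → G.Adj d y₀ → ¬ G.Adj d a' → False := by
    intro n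
    induction n using Nat.strong_induction_on with
    | _ n ih =>
      intro d a' hn ha' hya hdy hd hda
      obtain ⟨e, h1, h2, h3⟩ := hσ.exists_earlier hlast (hdy.trans hya)
        ha'.apart_right.1.symm (hnbr d hdy hd).symm hda
      obtain ⟨d', h4, h5, h6⟩ := hσ e y₀ a' (h1.trans hdy) hya h2
        (hXY e (ha'.step h2.symm h3))
      exact ih (σ d') (by have := h4.trans h1; omega) d' a' rfl ha' hya
        (h4.trans (h1.trans hdy)) h5 h6
  have crossing : ∃ a a', ReachAvoiding G v x₀ a ∧ G.Adj a a' ∧ σ a < σ y₀ ∧ σ y₀ < σ a' ∧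
      (ReachAvoiding G v x₀ a' ∨ a' = p) := by
    by_cases hp'y : σ p' < σ y₀
    · exact ⟨p', p, hp', hpp.symm, hp'y, hyp₀, Or.inr rfl⟩
    · obtain ⟨a, ha, a', ha', haa, hra, hra'⟩ :=
        hp'.exists_exit (C := {u | σ u < σ y₀}) hlt hp'y
      exact ⟨a, a', hra, haa, ha, lt_of_le_of_ne (not_lt.mp ha') (hneq a' hra').symm,
        Or.inl hra'⟩
  obtain ⟨a, a', ha, haa, hay, hya, hor⟩ := crossing
  obtain ⟨d, h1, h2, h3⟩ := hσ a y₀ a' hay hya haa (hXY a ha)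
  rcases hor with ha' | rfl
  · exact descent _ d a' rfl ha' hya (h1.trans hay) h2 h3
  · refine h3 (hcl d a' (hnbr d (h1.trans hay) h2) hp ?_)
    rintro rfl
    exact absurd (h1.trans (hay.trans hya)) (lt_irrefl _)

/-- The last vertex of an LBFS ordering of an interval graph is admissible: no two vertices
are each reachable from it while avoiding the closed neighborhood of the other. -/
lemma IsLBFSOrdering.admissible (hσ : IsLBFSOrdering G σ) (hlast : ∀ u, σ u ≤ σ v)
    [Finite V] {l r : V → ℝ} (hm : IsIntervalModel G l r) {x y : V}
    (hx : ReachAvoiding G y v x) (hy : ReachAvoiding G x v y) : False := by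
  have hvx := hy.apart_left.symm
  have hvy := hx.apart_left.symm
  have hcl := fun a b ha hb => hσ.neighbors_adj hlast hm (a := a) (b := b) ha hb
  have hxy : ¬ ReachAvoiding G v x y := by
    intro h
    have h1 := (hm.apart_iff _ _).mp hvx
    have h2 := (hm.apart_iff _ _).mp hvy
    have h3 := (hm.apart_iff _ _).mp hx.apart_right
    have := hm.le v
    have := hm.le x
    have := hm.le y
    have := h.right_lt hm
    have := h.lt_left hm
    have := hx.right_lt hm
    have := hx.lt_left hm
    have := hy.right_lt hm
    have := hy.lt_left hm
    grind
  have first : ∀ u, Apart G v u → ∃ u₀, ReachAvoiding G v u u₀ ∧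
      ∀ w, ReachAvoiding G v u w → σ u₀ ≤ σ w := fun u hu =>
    Set.exists_min_image {w | ReachAvoiding G v u w} σ (Set.toFinite _)
      ⟨u, ReachAvoiding.refl hu⟩
  obtain ⟨x₀, hx₀, hxmin⟩ := first x hvx
  obtain ⟨y₀, hy₀, hymin⟩ := first y hvy
  obtain ⟨p, p', h1, h2, h3, h4⟩ := hx.exists_gate hvx
  obtain ⟨q, q', k1, k2, k3, k4⟩ := hy.exists_gate hvy
  have hne : ¬ ReachAvoiding G v x₀ y₀ := fun h => hxy ((hx₀.trans h).trans hy₀.symm)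
  rcases lt_trichotomy (σ x₀) (σ y₀) with h | h | h
  · exact not_reach_both_of_first_lt hσ hlast hcl hne
      (fun u hu => hymin u (hy₀.trans hu)) h hy₀.symm h1 h2 h3 (hx₀.symm.trans h4)
  · exact hne (σ.injective h ▸ ReachAvoiding.refl hx₀.apart_right)
  · exact not_reach_both_of_first_lt hσ hlast hcl (fun h => hne h.symm)
      (fun u hu => hxmin u (hx₀.trans hu)) h hx₀.symm k1 k2 k3 (hy₀.symm.trans k4)

end LBFS

/-- The vertices reachable from `v` while avoiding the closed neighborhood of `x`. -/
def visibleSet (G : SimpleGraph V) (v x : V) : Set V := {u | ReachAvoiding G x v u}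

/-- The model must be reversed on the vertices `x` with `visibleSet G v x = C`. -/
def MustFlip (G : SimpleGraph V) (l r : V → ℝ) (v : V) (C : Set V) : Prop :=
  ∃ x y z, visibleSet G v x = C ∧ visibleSet G v y = C ∧ r x < l y ∧ G.Adj x z ∧
    y ∈ visibleSet G v z

/-- The orientation of the nonadjacent pairs that puts `v` first: vertices are compared by
their visible sets, and ties are resolved by the model, reversed where necessary. -/
def sweepLT (G : SimpleGraph V) (l r : V → ℝ) (v x y : V) : Prop :=
  x ∈ visibleSet G v y ∨ (visibleSet G v x = visibleSet G v y ∧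
    ((¬ MustFlip G l r v (visibleSet G v x) ∧ r x < l y) ∨
      (MustFlip G l r v (visibleSet G v x) ∧ r y < l x)))

section Sweep

variable {l r : V → ℝ} {v : V}

lemma not_mem_visibleSet_self (x : V) : x ∉ visibleSet G v x := fun h => h.apart_right.1 rfl

lemma visibleSet_subset {x y : V} (hxy : Apart G x y) (h : y ∉ visibleSet G v x) :
    visibleSet G v x ⊆ visibleSet G v y := fun _ hu => hu.subset_of_not_reach hxy h

/-- Where a walk leaves the visible set shared by two vertices apart, there is a vertex
adjacent to all vertices with that visible set. -/
lemma exists_common_separator (hcl : ∀ a b, G.Adj v a → G.Adj v b → a ≠ b → G.Adj a b)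
    {x y z : V} (hxy : Apart G x y) (hC : visibleSet G v x = visibleSet G v y)
    (hz : y ∈ visibleSet G v z) :
    ∃ s ∈ visibleSet G v z, ∀ w, visibleSet G v w = visibleSet G v y → G.Adj s w := by
  have hv : v ∈ visibleSet G v y := by
    by_contra hvy
    have near : ∀ w, v ∉ visibleSet G v w → w = v ∨ G.Adj v w := by
      intro w hw
      by_contra! h
      exact hw (ReachAvoiding.refl ⟨h.1, fun e => h.2 e.symm⟩)
    rcases near x (hC ▸ hvy) with rfl | hx <;> rcases near y hvy with rfl | hy
    · exact hxy.1 rfl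
    · exact hxy.2 hy
    · exact hxy.2 hx.symm
    · exact hxy.2 (hcl x y hx hy hxy.1)
  obtain ⟨c, hc, s, hs, hcs, -, hzs⟩ :=
    ReachAvoiding.exists_exit hz hv (not_mem_visibleSet_self y)
  refine ⟨s, hzs, fun w hw => ?_⟩
  rw [← hw] at hc hs
  by_contra hsw
  refine hs (ReachAvoiding.step hc hcs ⟨?_, fun e => hsw e.symm⟩)
  rintro rfl
  exact hc.apart_right.2 hcs.symm

/-- Two vertices with equal visible sets are not forced in both directions. -/
lemma flip_consistent (hm : IsIntervalModel G l r)
    (hcl : ∀ a b, G.Adj v a → G.Adj v b → a ≠ b → G.Adj a b)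
    (hadm : ∀ x y, ReachAvoiding G y v x → ReachAvoiding G x v y → False)
    {x y z x' y' z' : V} (hxC : visibleSet G v x = visibleSet G v y)
    (hx'C : visibleSet G v x' = visibleSet G v y)
    (hy'C : visibleSet G v y' = visibleSet G v y)
    (hxy : r x < l y) (hxz : G.Adj x z) (hyz : y ∈ visibleSet G v z)
    (hxy' : r y' < l x') (hxz' : G.Adj x' z') (hyz' : y' ∈ visibleSet G v z') : False := by
  obtain ⟨s, hs, hsD⟩ := exists_common_separator hcl ((hm.apart_iff x y).mpr (.inl hxy)) hxC hyz
  obtain ⟨s', hs', hsD'⟩ := exists_common_separator hcl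
    ((hm.apart_iff x' y').mpr (.inr hxy')) (hx'C.trans hy'C.symm) hyz'
  rw [hy'C] at hsD'
  have a1 := (hm.adj_iff _ _).mp (hsD x hxC)
  have a2 := (hm.adj_iff _ _).mp (hsD y rfl)
  have a3 := (hm.adj_iff _ _).mp (hsD x' hx'C)
  have a4 := (hm.adj_iff _ _).mp (hsD y' hy'C)
  have b1 := (hm.adj_iff _ _).mp (hsD' x hxC)
  have b2 := (hm.adj_iff _ _).mp (hsD' y rfl)
  have b3 := (hm.adj_iff _ _).mp (hsD' x' hx'C)
  have b4 := (hm.adj_iff _ _).mp (hsD' y' hy'C)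
  have e1 := (hm.adj_iff _ _).mp hxz
  have e2 := (hm.adj_iff _ _).mp hxz'
  have f1 := (hm.apart_iff _ _).mp hyz.apart_right
  have f2 := (hm.apart_iff _ _).mp hyz'.apart_right
  have f3 := (hm.apart_iff _ _).mp hs.apart_right
  have f4 := (hm.apart_iff _ _).mp hs'.apart_right
  have hzs : r z < l s := by grind
  have hsz' : r s' < l z' := by grind
  have hss : l s ≤ r s' := by linarith
  have hzz : Apart G z z' := (hm.apart_iff _ _).mpr (.inl (by linarith))
  have r1 : ReachAvoiding G z v z' := by
    by_cases h : G.Adj s z'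
    · exact ReachAvoiding.step hs h hzz
    · refine (ReachAvoiding.step hs (hsD x' hx'C) ((hm.apart_iff _ _).mpr (.inl ?_))).step hxz' hzz
      linarith
  have r2 : ReachAvoiding G z' v z := by
    by_cases h : G.Adj s' z
    · exact ReachAvoiding.step hs' h hzz.symm
    · refine (ReachAvoiding.step hs' (hsD' x hxC) ((hm.apart_iff _ _).mpr (.inr ?_))).step hxz hzz.symm
      linarith
  exact hadm _ _ r1 r2

lemma sweepLT.apart (hm : IsIntervalModel G l r) {x y : V} (h : sweepLT G l r v x y) :
    Apart G x y := by
  rcases h with h | ⟨-, ⟨-, h⟩ | ⟨-, h⟩⟩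
  · exact h.apart_right.symm
  · exact (hm.apart_iff _ _).mpr (.inl h)
  · exact (hm.apart_iff _ _).mpr (.inr h)

lemma sweepLT_total (hm : IsIntervalModel G l r) {x y : V} (h : Apart G x y) :
    sweepLT G l r v x y ∨ sweepLT G l r v y x := by
  by_cases hx : x ∈ visibleSet G v y
  · exact .inl (.inl hx)
  by_cases hy : y ∈ visibleSet G v x
  · exact .inr (.inl hy)
  have heq := (visibleSet_subset h hy).antisymm (visibleSet_subset h.symm hx)
  have := (hm.apart_iff _ _).mp h
  unfold sweepLT
  rw [heq]
  tauto

lemma sweepLT.trans (hm : IsIntervalModel G l r)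
    (hcl : ∀ a b, G.Adj v a → G.Adj v b → a ≠ b → G.Adj a b)
    (hadm : ∀ x y, ReachAvoiding G y v x → ReachAvoiding G x v y → False)
    {x y z : V} (hxy : sweepLT G l r v x y) (hyz : sweepLT G l r v y z) :
    sweepLT G l r v x z := by
  have hxy' := hxy.apart hm
  have hyz' := hyz.apart hm
  rcases hxy with hxy | ⟨hC, hxy⟩
  · left
    rcases hyz with hyz | ⟨hC, -⟩
    · exact visibleSet_subset hyz' (fun h => hadm _ _ hyz h) hxy
    · exact hC ▸ hxy
  rcases hyz with hyz | ⟨hC', hyz⟩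
  · left
    by_contra hxz
    have hzx : z ∉ visibleSet G v x := by
      rw [hC]
      exact fun h => hadm _ _ hyz h
    by_cases hfar : Apart G x z
    · have := visibleSet_subset hfar.symm hxz hyz
      exact not_mem_visibleSet_self y (hC ▸ this)
    · have hadj : G.Adj x z := by
        by_contra h
        refine hfar ⟨?_, h⟩
        rintro rfl
        exact not_mem_visibleSet_self y (hC ▸ hyz)
      rcases hxy with ⟨hf, hxy⟩ | ⟨⟨x', y', z', h1, h2, h3, h4, h5⟩, hxy⟩
      · exact hf ⟨x, y, z, rfl, hC.symm, hxy, hadj, hyz⟩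
      · exact flip_consistent hm hcl hadm (h1.trans h2.symm) h2.symm (hC.symm.trans h2.symm)
          h3 h4 h5 hxy hadj hyz
  · right
    refine ⟨hC.trans hC', ?_⟩
    have := hm.le y
    rw [← hC] at hyz
    rcases hxy with ⟨hf, hxy⟩ | ⟨hf, hxy⟩ <;> rcases hyz with ⟨hg, hyz⟩ | ⟨hg, hyz⟩
    · exact .inl ⟨hf, by linarith⟩
    · exact absurd hg hf
    · exact absurd hf hg
    · exact .inr ⟨hf, by linarith⟩

end Sweep

section CliqueOrder

variable {lt : V → V → Prop}

/-- A transitive orientation of the nonadjacent pairs of an interval graph contains no `2 + 2`. -/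
lemma IsIntervalModel.two_add_two_free {l r : V → ℝ} (hm : IsIntervalModel G l r)
    (hapart : ∀ x y, lt x y → Apart G x y)
    (htotal : ∀ x y, Apart G x y → lt x y ∨ lt y x)
    (htrans : ∀ x y z, lt x y → lt y z → lt x z) {a b c d : V} (hab : lt a b) (hcd : lt c d) :
    lt a d ∨ lt c b := by
  by_contra! hcon
  obtain ⟨had, hcb⟩ := hcon
  have h1 : ¬ Apart G a d := fun h => (htotal a d h).elim had fun h' =>
    hcb (htrans _ _ _ hcd (htrans _ _ _ h' hab))
  have h2 : ¬ Apart G c b := fun h => (htotal c b h).elim hcb fun h' =>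
    had (htrans _ _ _ hab (htrans _ _ _ h' hcd))
  have h3 : ¬ Apart G a c := fun h => (htotal a c h).elim
    (fun h' => had (htrans _ _ _ h' hcd)) fun h' => hcb (htrans _ _ _ h' hab)
  have h4 : ¬ Apart G b d := fun h => (htotal b d h).elim
    (fun h' => had (htrans _ _ _ hab h')) fun h' => hcb (htrans _ _ _ hcd h')
  have h5 := hapart _ _ hab
  have h6 := hapart _ _ hcd
  rw [hm.apart_iff] at h1 h2 h3 h4 h5 h6
  grind

lemma exists_apart_of_not_mem {K : Set V} (hK : Maximal G.IsClique K) {x : V} (hx : x ∉ K) :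
    ∃ y ∈ K, Apart G x y := by
  by_contra! hcon
  refine hx (hK.2 (y := insert x K) ?_ (Set.subset_insert x K) (Set.mem_insert x K))
  refine SimpleGraph.isClique_insert.mpr ⟨hK.1, fun b hb hne => ?_⟩
  by_contra h
  exact hcon b hb ⟨hne, h⟩

lemma exists_equiv_fin_of_isStrictTotalOrder {Q : Type*} [Finite Q] [Nonempty Q]
    (R : Q → Q → Prop) [IsStrictTotalOrder Q R] :
    ∃ (ℓ : ℕ) (e : Fin (ℓ + 1) ≃ Q), ∀ i j, R (e i) (e j) → i < j := by
  classical
  let _ : LinearOrder Q := linearOrderOfSTO R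
  let _ : Fintype Q := Fintype.ofFinite Q
  obtain ⟨ℓ, hℓ⟩ := Nat.exists_eq_succ_of_ne_zero (Fintype.card_ne_zero (α := Q))
  let e : Fin (ℓ + 1) ≃o Q := Fintype.orderIsoFinOfCardEq Q hℓ
  exact ⟨ℓ, e.toEquiv, fun i j h => e.lt_iff_lt.mp h⟩

/-- A transitive orientation of the nonadjacent pairs without `2 + 2` sorts the maximal cliques
into a clique path. -/
lemma exists_cliquePath_of_orientation [Finite V]
    (hapart : ∀ x y, lt x y → Apart G x y)
    (htotal : ∀ x y, Apart G x y → lt x y ∨ lt y x)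
    (hfree : ∀ a b c d, lt a b → lt c d → lt a d ∨ lt c b)
    {K₀ : Set V} (hK₀ : Maximal G.IsClique K₀) :
    ∃ (ℓ : ℕ) (K : Fin (ℓ + 1) → Finset V), IsCliquePath G K ∧
      ∀ i j x y, x ∈ K i → y ∈ K j → lt x y → i < j := by
  classical
  have hcl : ∀ {K : Set V}, Maximal G.IsClique K → ∀ x ∈ K, ∀ y ∈ K, ¬ lt x y :=
    fun hK x hx y hy h => (hapart x y h).2 (hK.1 hx hy (hapart x y h).1)
  let Q := {K : Set V // Maximal G.IsClique K}
  let R : Q → Q → Prop := fun K L => ∃ x ∈ K.1, ∃ y ∈ L.1, lt x y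
  have hR : IsStrictTotalOrder Q R :=
    { trichotomous := by
        intro K L h1 h2
        by_contra hne
        have hsub : ¬ K.1 ⊆ L.1 := fun h =>
          hne (Subtype.ext (h.antisymm (K.2.2 L.2.1 h)))
        obtain ⟨x, hx, hxL⟩ := Set.not_subset.mp hsub
        obtain ⟨y, hy, hxy⟩ := exists_apart_of_not_mem L.2 hxL
        rcases htotal x y hxy with h | h
        · exact h1 ⟨x, hx, y, hy, h⟩
        · exact h2 ⟨y, hy, x, hx, h⟩
      irrefl := fun K ⟨x, hx, y, hy, h⟩ => hcl K.2 x hx y hy h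
      trans := by
        rintro K L M ⟨x, hx, y, hy, h⟩ ⟨y', hy', z, hz, h'⟩
        rcases hfree _ _ _ _ h h' with h'' | h''
        · exact ⟨x, hx, z, hz, h''⟩
        · exact absurd h'' (hcl L.2 y' hy' y hy) }
  have : Nonempty Q := ⟨⟨K₀, hK₀⟩⟩
  obtain ⟨ℓ, e, he⟩ := exists_equiv_fin_of_isStrictTotalOrder R
  let K : Fin (ℓ + 1) → Finset V := fun i => (Set.toFinite (e i).1).toFinset
  have hK : ∀ i, (K i : Set V) = (e i).1 := fun i => Set.Finite.coe_toFinset _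
  have hmem : ∀ i x, x ∈ K i ↔ x ∈ (e i).1 := fun i x => Set.Finite.mem_toFinset _
  have hmax : ∀ i, Maximal G.IsClique (K i : Set V) := fun i => by
    rw [hK]
    exact (e i).2
  have hlt : ∀ i j x y, x ∈ K i → y ∈ K j → lt x y → i < j := by
    exact fun i j x y hx hy h => he i j ⟨x, (hmem i x).mp hx, y, (hmem j y).mp hy, h⟩
  have hcomplete : ∀ s : Set V, Maximal G.IsClique s → ∃ i, (K i : Set V) = s := fun s hs =>
    ⟨e.symm ⟨s, hs⟩, by rw [hK, e.apply_symm_apply]⟩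
  refine ⟨ℓ, K, ⟨?_, hmax, hcomplete, ?_, ?_⟩, hlt⟩
  · intro i j hij
    apply e.injective
    apply Subtype.ext
    rw [← hK, ← hK, hij]
  · intro u
    obtain ⟨s, hus, hs⟩ := (Set.toFinite {s : Set V | G.IsClique s}).exists_le_maximal
      (isClique_singleton u : G.IsClique {u})
    obtain ⟨i, hi⟩ := hcomplete s hs
    exact ⟨i, Finset.mem_coe.mp (hi ▸ hus rfl)⟩
  · intro u i j k hij hjk hi hk
    by_contra hj
    obtain ⟨w, hw, huw⟩ := exists_apart_of_not_mem (hmax j) hj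
    rcases htotal u w huw with h | h
    · exact absurd (hlt k j u w hk hw h) (not_lt.mpr hjk)
    · exact absurd (hlt j i w u hw hi h) (not_lt.mpr hij)

end CliqueOrder

end EndVertex

/-- for every end vertex `v` of an interval graph there is a clique path
such that `v` is a simplicial vertex belonging to the first maximal clique. -/
theorem end_vertex_simplicial_in_first_clique {V : Type*} [Finite V]
    (G : SimpleGraph V) (hG : IsIntervalGraph G)
    (v : V) (hv : IsEndVertex G v) :
    ∃ (ℓ : ℕ) (K : Fin (ℓ + 1) → Finset V),
      IsCliquePath G K ∧ IsSimplicial G v ∧ v ∈ K 0 := by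
  obtain ⟨l, r, hm⟩ := hG.exists_model
  obtain ⟨σ, hσ, hlast⟩ := hv
  have hcl : ∀ a b, G.Adj v a → G.Adj v b → a ≠ b → G.Adj a b :=
    fun a b ha hb => hσ.neighbors_adj hlast hm ha hb
  have hadm : ∀ x y, ReachAvoiding G y v x → ReachAvoiding G x v y → False :=
    fun x y => hσ.admissible hlast hm
  have hsimp : IsSimplicial G v :=
    SimpleGraph.isClique_insert.mpr ⟨fun a ha b hb => hcl a b ha hb, fun b hb _ => hb⟩
  have hmax : Maximal G.IsClique (insert v (G.neighborSet v)) := by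
    refine ⟨hsimp, fun s hs hle x hx => ?_⟩
    by_cases hxv : x = v
    · exact .inl hxv
    · exact .inr (hs (hle (Set.mem_insert _ _)) hx (Ne.symm hxv))
  have hapart : ∀ x y, sweepLT G l r v x y → Apart G x y := fun _ _ h => h.apart hm
  have htotal : ∀ x y, Apart G x y → sweepLT G l r v x y ∨ sweepLT G l r v y x :=
    fun _ _ => sweepLT_total hm
  obtain ⟨ℓ, K, hK, hlt⟩ := exists_cliquePath_of_orientation hapart htotal
    (fun _ _ _ _ => hm.two_add_two_free hapart htotal
      fun _ _ _ h h' => h.trans hm hcl hadm h') hmax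
  refine ⟨ℓ, K, hK, hsimp, ?_⟩
  obtain ⟨j, hj⟩ := hK.complete _ hmax
  have hvj : v ∈ K j := Finset.mem_coe.mp (hj ▸ Set.mem_insert _ _)
  by_contra hv0
  obtain ⟨w, hw, hvw⟩ := exists_apart_of_not_mem (hK.maxClique 0) hv0
  have hvw' : sweepLT G l r v v w := .inl (ReachAvoiding.refl hvw.symm)
  exact absurd (hlt j 0 v w hvj hw hvw') (Fin.not_lt_zero j)
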